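/- Let G be an extraspecial p-group of order p^(2n+1) with n ≥ 2. Then the Schur multiplier M(G) = H²(G, ℂ*) is an elementary abelian p-group of order p^(2n²−n−1). -/

import Mathlib

/-!
Setting (central products): `G` is a group with normal subgroups `H` and `K` such that
`G = HK` (i.e. `H ⊔ K = ⊤`) and `[H, K] = 1` (i.e. every element of `H` commutes with
every element of `K`).  We set `A = H ⊓ K` and `Z = ⁅H,H⁆ ⊓ ⁅K,K⁆`; both are central
in `G`.  Coefficients are taken in a divisible abelian group `D`, regarded as a trivial
module.  Second cohomology `H2 X D` is realized concretely as (inhomogeneous)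
2-cocycles modulo 2-coboundaries, and `Hom(X, D)` is realized as `Additive X →+ D`.
-/

open scoped TensorProduct

set_option maxHeartbeats 1000000
set_option synthInstance.maxHeartbeats 1000000
set_option synthInstance.maxSize 2000

namespace SchurCP

variable (G : Type) [Group G] (D : Type) [AddCommGroup D]

/-- The group of 2-cocycles on `G` with values in the trivial module `D`. -/
def cocycles2 : AddSubgroup (G → G → D) where
  carrier := {f | ∀ g h k : G, f g h + f (g * h) k = f h k + f g (h * k)}
  zero_mem' := by intro g h k; simp
  add_mem' := by
    intro a b ha hb g h k
    simp only [Pi.add_apply]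
    rw [add_add_add_comm, ha g h k, hb g h k, add_add_add_comm]
  neg_mem' := by
    intro a ha g h k
    simp only [Pi.neg_apply]
    rw [← neg_add, ← neg_add, ha g h k]

/-- The group of 2-coboundaries on `G` with values in the trivial module `D`. -/
def coboundaries2 : AddSubgroup (G → G → D) where
  carrier := {f | ∃ φ : G → D, ∀ g h : G, f g h = φ g + φ h - φ (g * h)}
  zero_mem' := ⟨0, by simp⟩
  add_mem' := by
    rintro a b ⟨φ, hφ⟩ ⟨ψ, hψ⟩
    exact ⟨φ + ψ, fun g h => by simp only [Pi.add_apply, hφ g h, hψ g h]; abel⟩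
  neg_mem' := by
    rintro a ⟨φ, hφ⟩
    exact ⟨-φ, fun g h => by simp only [Pi.neg_apply, hφ g h]; abel⟩

/-- The second cohomology group `H²(G, D)` of `G` with coefficients in the
trivial module `D`. -/
def H2 : Type := cocycles2 G D ⧸ (coboundaries2 G D).addSubgroupOf (cocycles2 G D)

instance : AddCommGroup (H2 G D) :=
  QuotientAddGroup.Quotient.addCommGroup ((coboundaries2 G D).addSubgroupOf (cocycles2 G D))

variable {G D}

/-- The cohomology class of a 2-cocycle. -/
abbrev H2mk (f : cocycles2 G D) : H2 G D := QuotientAddGroup.mk f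

/-- Pullback of a 2-cocycle along a group homomorphism. -/
def pullCocycle {G' : Type} [Group G'] (π : G' →* G) :
    cocycles2 G D →+ cocycles2 G' D where
  toFun f := ⟨fun x y => (f : G → G → D) (π x) (π y), by
    intro x y z
    simpa only [map_mul] using f.2 (π x) (π y) (π z)⟩
  map_zero' := rfl
  map_add' _ _ := rfl

/-- The homomorphism `H²(G, D) → H²(G', D)` induced by a group homomorphism
`π : G' → G`; this specializes to restriction maps (for inclusions of subgroups)
and to inflation maps (for quotient maps). -/
def H2Map {G' : Type} [Group G'] (π : G' →* G) : H2 G D →+ H2 G' D :=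
  QuotientAddGroup.map _ _ (pullCocycle π) (by
    intro f hf
    rw [AddSubgroup.mem_addSubgroupOf] at hf
    rw [AddSubgroup.mem_comap, AddSubgroup.mem_addSubgroupOf]
    obtain ⟨φ, hφ⟩ := hf
    exact ⟨fun x => φ (π x), fun x y => by
      show (f : G → G → D) (π x) (π y) = _
      rw [hφ (π x) (π y), ← map_mul]⟩)

theorem commutator_le_self {X : Type} [Group X] (H : Subgroup X) : ⁅H, H⁆ ≤ H := by
  rw [Subgroup.commutator_le]
  intro g₁ h₁ g₂ h₂
  rw [commutatorElement_def]
  exact H.mul_mem (H.mul_mem (H.mul_mem h₁ h₂) (H.inv_mem h₁)) (H.inv_mem h₂)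

theorem inf_commutator_le_inf {X : Type} [Group X] (H K : Subgroup X) :
    ⁅H, H⁆ ⊓ ⁅K, K⁆ ≤ H ⊓ K :=
  inf_le_inf (commutator_le_self H) (commutator_le_self K)

theorem subgroupOf_le {X : Type} [Group X] {B C : Subgroup X} (h : B ≤ C)
    (J : Subgroup X) : B.subgroupOf J ≤ C.subgroupOf J := fun _x hx => h hx

/-- The natural projection `X/N → X/M` for `N ≤ M`. -/
def quotProj {X : Type} [Group X] {N M : Subgroup X} [N.Normal] [M.Normal] (h : N ≤ M) :
    (X ⧸ N) →* (X ⧸ M) :=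
  QuotientGroup.map N M (MonoidHom.id X) (by rwa [Subgroup.comap_id])

/-- The inflation homomorphism `H²(X/M, D) → H²(X/N, D)` for `N ≤ M`. -/
def inflMap {X : Type} [Group X] {N M : Subgroup X} [N.Normal] [M.Normal]
    (h : N ≤ M) (D : Type) [AddCommGroup D] : H2 (X ⧸ M) D →+ H2 (X ⧸ N) D :=
  H2Map (quotProj h)

/-- The natural homomorphism `H/(A ∩ H) → X/A` for subgroups `A, H` of `X`;
for `A ≤ H` this realizes `H/A` as a subgroup of `X/A`. -/
def quotInclusion {X : Type} [Group X] (H A : Subgroup X) [A.Normal]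
    [(A.subgroupOf H).Normal] : (↥H ⧸ A.subgroupOf H) →* X ⧸ A :=
  QuotientGroup.map (A.subgroupOf H) A H.subtype (fun _x hx => hx)

/-- The abelian tensor product `X ⊗ Y = X/[X,X] ⊗_ℤ Y/[Y,Y]` of two groups. -/
abbrev AbTensor (X Y : Type) [Group X] [Group Y] : Type :=
  TensorProduct ℤ (Additive (Abelianization X)) (Additive (Abelianization Y))

/-- The element `x[X,X] ⊗ y[Y,Y]` of the abelian tensor product. -/
noncomputable abbrev tmulAb {X Y : Type} [Group X] [Group Y] (x : X) (y : Y) :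
    AbTensor X Y :=
  Additive.ofMul (Abelianization.of x) ⊗ₜ[ℤ] Additive.ofMul (Abelianization.of y)

/-- The map on abelian tensor products induced by a pair of group homomorphisms. -/
noncomputable def abTensorMap {X Y X' Y' : Type} [Group X] [Group Y] [Group X'] [Group Y']
    (f : X →* X') (g : Y →* Y') : AbTensor X Y →ₗ[ℤ] AbTensor X' Y' :=
  TensorProduct.map (MonoidHom.toAdditive (Abelianization.map f)).toIntLinearMap
    (MonoidHom.toAdditive (Abelianization.map g)).toIntLinearMap

/-- The coboundary of a function, as a 2-cocycle. -/
def coboundary (φ : G → D) : cocycles2 G D :=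
  ⟨fun g h => φ g + φ h - φ (g * h), fun g h k => by beta_reduce; rw [mul_assoc]; abel⟩

theorem H2mk_surjective : Function.Surjective (H2mk : cocycles2 G D → H2 G D) :=
  QuotientAddGroup.mk_surjective

theorem H2mk_eq_zero_iff (f : cocycles2 G D) :
    H2mk f = 0 ↔ ∃ φ : G → D, ∀ g h, f.1 g h = φ g + φ h - φ (g * h) :=
  (QuotientAddGroup.eq_zero_iff f).trans AddSubgroup.mem_addSubgroupOf

section CentralExtension

theorem cocycle_one_left (f : cocycles2 G D) (g : G) : f.1 1 g = f.1 1 1 := by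
  simpa using (f.2 1 1 g).symm

theorem cocycle_one_right (f : cocycles2 G D) (g : G) : f.1 g 1 = f.1 1 1 := by
  simpa using f.2 g 1 1

/-- The central extension of `G` by `D` determined by a 2-cocycle. -/
@[ext]
structure CocycleExt (f : cocycles2 G D) : Type where
  /-- The component in the kernel. -/
  val : D
  /-- The projection to `G`. -/
  proj : G

namespace CocycleExt

variable (f : cocycles2 G D)

instance : Mul (CocycleExt f) := ⟨fun x y => ⟨x.val + y.val + f.1 x.proj y.proj, x.proj * y.proj⟩⟩

instance : One (CocycleExt f) := ⟨⟨-f.1 1 1, 1⟩⟩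

instance : Inv (CocycleExt f) :=
  ⟨fun x => ⟨-x.val - f.1 x.proj⁻¹ x.proj - f.1 1 1, x.proj⁻¹⟩⟩

theorem mul_def (x y : CocycleExt f) :
    x * y = ⟨x.val + y.val + f.1 x.proj y.proj, x.proj * y.proj⟩ := rfl

theorem one_def : (1 : CocycleExt f) = ⟨-f.1 1 1, 1⟩ := rfl

theorem inv_def (x : CocycleExt f) :
    x⁻¹ = ⟨-x.val - f.1 x.proj⁻¹ x.proj - f.1 1 1, x.proj⁻¹⟩ := rfl

instance : Group (CocycleExt f) :=
  Group.ofLeftAxioms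
    (fun x y z => by
      ext
      · have h := f.2 x.proj y.proj z.proj
        simp only [mul_def]
        grind
      · exact mul_assoc _ _ _)
    (fun x => by
      ext
      · simp [mul_def, one_def, cocycle_one_left]
      · exact one_mul _)
    (fun x => by
      ext
      · simp only [mul_def, one_def, inv_def]
        abel
      · exact inv_mul_cancel _)

/-- The inclusion of the kernel. -/
def incl : Multiplicative D →* CocycleExt f where
  toFun a := ⟨a.toAdd - f.1 1 1, 1⟩
  map_one' := by ext <;> simp [one_def]
  map_mul' a b := by
    ext
    · simp only [mul_def, toAdd_mul, mul_one]
      abel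
    · simp [mul_def]

theorem incl_mul (a : D) (x : CocycleExt f) :
    incl f (.ofAdd a) * x = ⟨a + x.val, x.proj⟩ := by
  ext
  · simp only [mul_def, incl, MonoidHom.coe_mk, OneHom.coe_mk, toAdd_ofAdd, cocycle_one_left]
    abel
  · simp [mul_def, incl]

theorem mul_incl (a : D) (x : CocycleExt f) :
    x * incl f (.ofAdd a) = ⟨a + x.val, x.proj⟩ := by
  ext
  · simp only [mul_def, incl, MonoidHom.coe_mk, OneHom.coe_mk, toAdd_ofAdd, cocycle_one_right]
    abel
  · simp [mul_def, incl]

theorem incl_mem_center (a : Multiplicative D) : incl f a ∈ Subgroup.center (CocycleExt f) :=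
  Subgroup.mem_center_iff.2 fun x => by
    rw [← ofAdd_toAdd a, incl_mul, mul_incl]

theorem exists_incl_mul_of_proj_eq {x y : CocycleExt f} (h : x.proj = y.proj) :
    ∃ a, x = incl f a * y :=
  ⟨.ofAdd (x.val - y.val), by rw [incl_mul]; ext <;> simp [h]⟩

end CocycleExt

/-- If `a` and `b` commute with `g` up to central factors, then their commutator `x` commutes
with `g`. -/
theorem commute_of_commute_up_to_center {E : Type} [Group E] {a b g x c d : E}
    (hc : c ∈ Subgroup.center E) (hd : d ∈ Subgroup.center E) (hx : a * b = x * (b * a))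
    (ha : g * a = c * (a * g)) (hb : g * b = d * (b * g)) : g * x = x * g := by
  rw [Subgroup.mem_center_iff] at hc hd
  have h₁ : g * (a * b) = c * d * (a * b * g) := by
    rw [← mul_assoc, ha, mul_assoc, mul_assoc, hb, ← mul_assoc a d, hd a]
    simp only [mul_assoc]
  have h₂ : g * (b * a) = c * d * (b * a * g) := by
    rw [← mul_assoc, hb, mul_assoc, mul_assoc, ha, ← mul_assoc b c, hc b, hd c]
    simp only [mul_assoc]
  have hcd : c * d * x = x * (c * d) := by
    rw [mul_assoc, ← hd x, ← mul_assoc, ← hc x, mul_assoc]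
  refine mul_right_cancel (b := b * a) ?_
  calc g * x * (b * a) = g * (a * b) := by rw [hx, mul_assoc]
    _ = c * d * x * (b * a * g) := by rw [h₁, hx]; simp only [mul_assoc]
    _ = x * g * (b * a) := by rw [hcd, mul_assoc x g, h₂, mul_assoc x]

theorem exists_cobounding_of_symm {X : Type} [CommGroup X] [DivisibleBy D ℤ] (f : cocycles2 X D)
    (hf : ∀ x y, f.1 x y = f.1 y x) : ∃ φ : X → D, ∀ x y, f.1 x y = φ x + φ y - φ (x * y) := by
  let _ : CommGroup (CocycleExt f) :=
    { (inferInstance : Group (CocycleExt f)) with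
      mul_comm := fun x y => by
        ext
        · simp only [CocycleExt.mul_def, hf x.proj, add_comm x.val]
        · exact mul_comm _ _ }
  have inj : Function.Injective (CocycleExt.incl f) := fun a b h => by
    simpa [CocycleExt.incl] using h
  obtain ⟨r, hr⟩ := (Module.Baer.injective (Module.Baer.of_divisible D)).out
    (MonoidHom.toAdditiveRight (CocycleExt.incl f)).toIntLinearMap inj LinearMap.id
  have hr' (a : D) (x : CocycleExt f) :
      r (.ofMul ⟨a + x.val, x.proj⟩) = a + r (.ofMul x) := by
    rw [← CocycleExt.incl_mul, ofMul_mul, map_add]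
    congr 1
    exact hr a
  refine ⟨fun x => r (.ofMul ⟨0, x⟩), fun x y => ?_⟩
  rw [← map_add, ← ofMul_mul, CocycleExt.mul_def]
  have := hr' (f.1 x y) ⟨0, x * y⟩
  simp only [add_zero, zero_add] at this ⊢
  rw [this]
  abel

end CentralExtension

section LinearAlgebra

theorem exists_orthogonal_pair {F V : Type} [Field F] [AddCommGroup V] [Module F V]
    [FiniteDimensional F V] (ω : V →ₗ[F] V →ₗ[F] F) (hω : ∀ v, (∀ w, ω v w = 0) → v = 0)
    (hV : 2 < Module.finrank F V) (v : V) (c : F) :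
    ∃ a b, ω v a = 0 ∧ ω v b = 0 ∧ ω a b = c := by
  by_contra hcon
  have hzero (a b : V) (ha : ω v a = 0) (hb : ω v b = 0) : ω a b = 0 := by
    by_contra hab
    exact hcon ⟨(c / ω a b) • a, b, by simp [ha], hb, by simp [hab]⟩
  obtain ⟨t, ht⟩ : ∃ t, ω v t ≠ 0 := by
    by_contra! h
    have : Subsingleton V := subsingleton_of_forall_eq 0 fun a => hω a fun b => hzero a b (h a) (h b)
    rw [Module.finrank_zero_of_subsingleton] at hV
    omega
  have hinj : Function.Injective ((ω v).prod (ω.flip t)) := by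
    rw [injective_iff_map_eq_zero]
    intro a ha
    obtain ⟨ha₁, ha₂⟩ : ω v a = 0 ∧ ω a t = 0 := by simpa using ha
    refine hω a fun x => ?_
    have := hzero a (x - (ω v x / ω v t) • t) ha₁ (by simp [ht])
    simpa [ha₂] using this
  have := LinearMap.finrank_le_finrank_of_injective hinj
  simp at this
  omega

end LinearAlgebra

/-- Coordinates on an extraspecial-like group: a surjection onto `𝔽_p^m` whose kernel is a central
copy of `𝔽_p`, and such that the commutator is given by a nondegenerate bilinear form. -/
structure HeisenbergCoord (p m : ℕ) (G : Type) [Group G] where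
  /-- The projection. -/
  π : G → Fin m → ZMod p
  /-- The inclusion of the centre. -/
  ζ : ZMod p → G
  /-- The commutator form. -/
  ω : (Fin m → ZMod p) →ₗ[ZMod p] (Fin m → ZMod p) →ₗ[ZMod p] ZMod p
  π_mul : ∀ g h, π (g * h) = π g + π h
  π_surjective : Function.Surjective π
  ζ_add : ∀ k l, ζ (k + l) = ζ k * ζ l
  ζ_injective : Function.Injective ζ
  π_eq_zero_iff : ∀ g, π g = 0 ↔ ∃ k, ζ k = g
  mul_eq : ∀ g h, g * h = ζ (ω (π g) (π h)) * (h * g)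
  nondegenerate : ∀ v, (∀ w, ω v w = 0) → v = 0

namespace HeisenbergCoord

variable {p m : ℕ} (C : HeisenbergCoord p m G)

theorem ζ_zero : C.ζ 0 = 1 := by
  simpa using C.ζ_add 0 0

theorem π_ζ (k : ZMod p) : C.π (C.ζ k) = 0 := (C.π_eq_zero_iff _).2 ⟨k, rfl⟩

theorem π_one : C.π 1 = 0 := by rw [← C.ζ_zero, C.π_ζ]

theorem ζ_comm (k : ZMod p) (g : G) : C.ζ k * g = g * C.ζ k := by
  simpa [C.π_ζ, C.ζ_zero] using C.mul_eq (C.ζ k) g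

theorem ω_self (v : Fin m → ZMod p) : C.ω v v = 0 := by
  obtain ⟨g, rfl⟩ := C.π_surjective v
  apply C.ζ_injective
  rw [C.ζ_zero]
  simpa using C.mul_eq g g

/-- A set-theoretic section of the projection. -/
noncomputable def sec : (Fin m → ZMod p) → G := Function.surjInv C.π_surjective

theorem π_sec (v : Fin m → ZMod p) : C.π (C.sec v) = v := Function.surjInv_eq C.π_surjective v

theorem exists_eq_mul_ζ {g h : G} (e : C.π g = C.π h) : ∃ k, g = h * C.ζ k := by
  obtain ⟨k, hk⟩ := (C.π_eq_zero_iff (h⁻¹ * g)).1 <| by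
    have h₁ := C.π_mul h (h⁻¹ * g)
    rw [mul_inv_cancel_left, e] at h₁
    simpa using h₁
  exact ⟨k, by rw [hk, mul_inv_cancel_left]⟩

theorem exists_eq_sec_mul_ζ (g : G) : ∃ k, g = C.sec (C.π g) * C.ζ k :=
  C.exists_eq_mul_ζ (C.π_sec _).symm

/-- The central coordinate relative to the chosen section. -/
noncomputable def κ (g : G) : ZMod p := (C.exists_eq_sec_mul_ζ g).choose

theorem sec_mul_ζ_κ (g : G) : C.sec (C.π g) * C.ζ (C.κ g) = g :=
  (C.exists_eq_sec_mul_ζ g).choose_spec.symm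

theorem κ_mul_ζ (g : G) (k : ZMod p) : C.κ (g * C.ζ k) = C.κ g + k := by
  apply C.ζ_injective
  have h := (C.sec_mul_ζ_κ (g * C.ζ k)).trans (congrArg (· * C.ζ k) (C.sec_mul_ζ_κ g).symm)
  rw [C.π_mul, C.π_ζ, add_zero, mul_assoc] at h
  have h' := mul_left_cancel h
  rw [h', C.ζ_add]

theorem cocycle_ζ_comm [Fact p.Prime] (hm : 2 < m) (f : cocycles2 G D) (k : ZMod p) (g : G) :
    f.1 (C.ζ k) g = f.1 g (C.ζ k) := by
  obtain ⟨a, b, ha, hb, hab⟩ :=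
    exists_orthogonal_pair C.ω C.nondegenerate (by simpa using hm) (C.π g) k
  obtain ⟨a, rfl⟩ := C.π_surjective a
  obtain ⟨b, rfl⟩ := C.π_surjective b
  have lift (x : G) : ∃ y : CocycleExt f, y.proj = x := ⟨⟨0, x⟩, rfl⟩
  obtain ⟨a', rfl⟩ := lift a
  obtain ⟨b', rfl⟩ := lift b
  obtain ⟨g', rfl⟩ := lift g
  have hga := C.mul_eq g'.proj a'.proj
  have hgb := C.mul_eq g'.proj b'.proj
  have hbc := C.mul_eq a'.proj b'.proj
  rw [ha, C.ζ_zero, one_mul] at hga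
  rw [hb, C.ζ_zero, one_mul] at hgb
  rw [hab] at hbc
  obtain ⟨c, hc⟩ := CocycleExt.exists_incl_mul_of_proj_eq f (x := g' * a') (y := a' * g') hga
  obtain ⟨d, hd⟩ := CocycleExt.exists_incl_mul_of_proj_eq f (x := g' * b') (y := b' * g') hgb
  obtain ⟨e, he⟩ := CocycleExt.exists_incl_mul_of_proj_eq f (x := a' * b')
    (y := ⟨0, C.ζ k⟩ * (b' * a')) hbc
  rw [← mul_assoc] at he
  have := commute_of_commute_up_to_center (CocycleExt.incl_mem_center f c)
    (CocycleExt.incl_mem_center f d) he hc hd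
  rw [← ofAdd_toAdd e, CocycleExt.incl_mul] at this
  have := congrArg CocycleExt.val this
  simp only [CocycleExt.mul_def] at this
  rw [add_comm g'.val] at this
  exact (add_left_cancel this).symm

theorem exists_inflated_of_trivial_ζ (f : cocycles2 G D)
    (hf : ∀ k g, f.1 (C.ζ k) g = f.1 g (C.ζ k)) (hf₀ : ∀ k l, f.1 (C.ζ k) (C.ζ l) = 0) :
    ∃ φ : G → D, ∀ g g' h h', C.π g = C.π g' → C.π h = C.π h' →
      (f - coboundary φ).1 g h = (f - coboundary φ).1 g' h' := by
  set φ : G → D := fun g => -f.1 (C.sec (C.π g)) (C.ζ (C.κ g)) with hφ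
  have φ_ζ (k) : φ (C.ζ k) = 0 := by
    obtain ⟨l, hl⟩ := (C.π_eq_zero_iff (C.sec 0)).1 (C.π_sec 0)
    simp only [hφ, C.π_ζ, ← hl, hf₀, neg_zero]
  set f' := f - coboundary φ
  have f'_apply (g h) : f'.1 g h = f.1 g h - (φ g + φ h - φ (g * h)) := rfl
  have right (g k) : f'.1 g (C.ζ k) = 0 := by
    rw [f'_apply, φ_ζ]
    simp only [hφ, C.π_mul, C.π_ζ, add_zero, C.κ_mul_ζ, C.ζ_add]
    have := f.2 (C.sec (C.π g)) (C.ζ (C.κ g)) (C.ζ k)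
    rw [C.sec_mul_ζ_κ, hf₀, zero_add] at this
    rw [← this]
    abel
  have left (g k) : f'.1 (C.ζ k) g = 0 := by
    rw [← right g k, f'_apply, f'_apply, hf, C.ζ_comm, add_comm (φ g)]
  refine ⟨φ, fun g g' h h' hg hh => ?_⟩
  obtain ⟨k, rfl⟩ := C.exists_eq_mul_ζ hg
  obtain ⟨l, rfl⟩ := C.exists_eq_mul_ζ hh
  rw [← C.ζ_comm, ← mul_one (C.ζ k * g')]
  have h₁ := f'.2 (C.ζ k) g' (h' * C.ζ l)
  have h₂ := f'.2 g' h' (C.ζ l)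
  rw [left, left, zero_add, add_zero] at h₁
  rw [right, right, zero_add, add_zero] at h₂
  rw [mul_one, h₁, ← h₂]

/-- A cocycle that only depends on classes modulo the centre, as a cocycle on the quotient. -/
noncomputable def descend (f : cocycles2 G D)
    (hf : ∀ g g' h h', C.π g = C.π g' → C.π h = C.π h' → f.1 g h = f.1 g' h') :
    cocycles2 (Multiplicative (Fin m → ZMod p)) D :=
  ⟨fun v w => f.1 (C.sec v.toAdd) (C.sec w.toAdd), fun u v w => by
    beta_reduce
    rw [hf (C.sec (u * v).toAdd) (C.sec u.toAdd * C.sec v.toAdd) _ _ (by simp [π_sec, π_mul]) rfl,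
      hf _ _ (C.sec (v * w).toAdd) (C.sec v.toAdd * C.sec w.toAdd) rfl (by simp [π_sec, π_mul])]
    exact f.2 _ _ _⟩

theorem exists_eq_inflated_add_coboundary [Fact p.Prime] [DivisibleBy D ℤ] (hm : 2 < m)
    (f : cocycles2 G D) :
    ∃ (F : cocycles2 (Multiplicative (Fin m → ZMod p)) D) (φ : G → D),
      ∀ g h, f.1 g h = F.1 (.ofAdd (C.π g)) (.ofAdd (C.π h)) + (φ g + φ h - φ (g * h)) := by
  have hf := C.cocycle_ζ_comm hm f
  obtain ⟨ψ, hψ⟩ := exists_cobounding_of_symm (X := Multiplicative (ZMod p))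
    ⟨fun k l => f.1 (C.ζ k.toAdd) (C.ζ l.toAdd), fun k l n => by
      simpa [C.ζ_add] using f.2 (C.ζ k.toAdd) (C.ζ l.toAdd) (C.ζ n.toAdd)⟩ (fun _ _ => hf _ _)
  set ψ' : G → D := Function.extend C.ζ (fun k => ψ (.ofAdd k)) 0
  have hψ' (k) : ψ' (C.ζ k) = ψ (.ofAdd k) := C.ζ_injective.extend_apply _ _ _
  obtain ⟨φ, hφ⟩ := C.exists_inflated_of_trivial_ζ (f - coboundary ψ')
    (fun k g => by
      change f.1 _ _ - (ψ' _ + ψ' _ - ψ' _) = f.1 _ _ - (ψ' _ + ψ' _ - ψ' _)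
      rw [hf, C.ζ_comm, add_comm (ψ' g)])
    (fun k l => by
      change f.1 _ _ - (ψ' _ + ψ' _ - ψ' _) = 0
      rw [← C.ζ_add, hψ', hψ', hψ', sub_eq_zero]
      exact hψ (.ofAdd k) (.ofAdd l))
  refine ⟨C.descend _ hφ, ψ' + φ, fun g h => ?_⟩
  have h₁ := hφ g (C.sec (C.π g)) h (C.sec (C.π h)) (C.π_sec _).symm (C.π_sec _).symm
  change _ = (f - coboundary ψ' - coboundary φ).1 _ _ + _
  rw [toAdd_ofAdd, toAdd_ofAdd, ← h₁]
  change _ = f.1 _ _ - (ψ' _ + ψ' _ - ψ' _) - (φ _ + φ _ - φ _) + _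
  simp only [Pi.add_apply]
  abel

theorem exists_cobounding_of_symm_of_inflated [DivisibleBy D ℤ] (f : cocycles2 G D)
    (hf : ∀ g g' h h', C.π g = C.π g' → C.π h = C.π h' → f.1 g h = f.1 g' h')
    (hs : ∀ g h, f.1 g h = f.1 h g) : ∃ φ : G → D, ∀ g h, f.1 g h = φ g + φ h - φ (g * h) := by
  obtain ⟨φ, hφ⟩ := exists_cobounding_of_symm (C.descend f hf) (fun _ _ => hs _ _)
  refine ⟨fun g => φ (.ofAdd (C.π g)), fun g h => ?_⟩
  beta_reduce
  rw [hf g _ h _ (C.π_sec (C.π g)).symm (C.π_sec (C.π h)).symm, C.π_mul]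
  exact hφ (.ofAdd (C.π g)) (.ofAdd (C.π h))

end HeisenbergCoord

/-- The antisymmetrization of a 2-cocycle on an abelian group is additive in the first variable. -/
theorem antisymm_mul_left {X : Type} [CommGroup X] (F : cocycles2 X D) (u v w : X) :
    F.1 (u * v) w - F.1 w (u * v) = (F.1 u w - F.1 w u) + (F.1 v w - F.1 w v) := by
  have h₁ := F.2 u v w
  have h₂ := F.2 w u v
  have h₃ := F.2 u w v
  rw [mul_comm w u] at h₂
  rw [mul_comm w v] at h₃
  grind

theorem exists_bilinear_of_biadditive {p : ℕ} {V W : Type} [AddCommGroup V] [Module (ZMod p) V]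
    [AddCommGroup W] [Module (ZMod p) W] (a : V → V → W)
    (hl : ∀ u v w, a (u + v) w = a u w + a v w) (hr : ∀ u v w, a u (v + w) = a u v + a u w) :
    ∃ α : V →ₗ[ZMod p] V →ₗ[ZMod p] W, ∀ v w, α v w = a v w :=
  ⟨(AddMonoidHom.mk' (fun v => (AddMonoidHom.mk' (a v) (hr v)).toZModLinearMap p)
    fun u v => LinearMap.ext fun w => hl u v w).toZModLinearMap p, fun _ _ => rfl⟩

section UpperForm

/-- The positions strictly above the diagonal of an `m × m` matrix. -/
abbrev UpperPairs (m : ℕ) : Type := {s : Fin m × Fin m // s.1 < s.2}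

theorem card_upperPairs (m : ℕ) : Nat.card (UpperPairs m) = m * (m - 1) / 2 := by
  rw [Nat.card_eq_fintype_card, Fintype.card_subtype, ← Finset.sum_range_id,
    Finset.sum_range, Finset.card_filter, ← Finset.univ_product_univ, Finset.sum_product_right]
  refine Finset.sum_congr rfl fun j _ => ?_
  rw [← Finset.card_filter, ← Fin.card_Iio j]
  congr 1
  ext i
  simp

variable {F : Type} [Field F] {m : ℕ}

/-- The bilinear form with a given strictly upper triangular matrix. -/
def upperForm (M : UpperPairs m → F) : (Fin m → F) →ₗ[F] (Fin m → F) →ₗ[F] F :=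
  LinearMap.mk₂ F (fun v w => ∑ s, M s * (v s.1.1 * w s.1.2))
    (fun u v w => by simp only [Pi.add_apply, add_mul, mul_add, Finset.sum_add_distrib])
    (fun c v w => by
      rw [smul_eq_mul, Finset.mul_sum]
      exact Finset.sum_congr rfl fun s _ => by simp only [Pi.smul_apply, smul_eq_mul]; ring)
    (fun u v w => by simp only [Pi.add_apply, mul_add, Finset.sum_add_distrib])
    (fun c v w => by
      rw [smul_eq_mul, Finset.mul_sum]
      exact Finset.sum_congr rfl fun s _ => by simp only [Pi.smul_apply, smul_eq_mul]; ring)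

theorem upperForm_apply (M : UpperPairs m → F) (v w : Fin m → F) :
    upperForm M v w = ∑ s, M s * (v s.1.1 * w s.1.2) := rfl

theorem upperForm_add (M N : UpperPairs m → F) (v w : Fin m → F) :
    upperForm (M + N) v w = upperForm M v w + upperForm N v w := by
  simp only [upperForm_apply, Pi.add_apply, add_mul, Finset.sum_add_distrib]

theorem upperForm_smul (c : F) (M : UpperPairs m → F) (v w : Fin m → F) :
    upperForm (c • M) v w = c * upperForm M v w := by
  simp only [upperForm_apply, Pi.smul_apply, smul_eq_mul, mul_assoc, Finset.mul_sum]

theorem upperForm_single (M : UpperPairs m → F) (i j : Fin m) :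
    upperForm M (Pi.single i 1) (Pi.single j 1) = if h : i < j then M ⟨(i, j), h⟩ else 0 := by
  rw [upperForm_apply]
  split_ifs with h
  · rw [Finset.sum_eq_single ⟨(i, j), h⟩]
    · simp
    · rintro ⟨⟨a, b⟩, hs⟩ - hne
      by_cases ha : a = i
      · by_cases hb : b = j
        · subst ha hb
          exact absurd rfl hne
        · simp [hb]
      · simp [ha]
    · simp
  · refine Finset.sum_eq_zero ?_
    rintro ⟨⟨a, b⟩, hs⟩ -
    by_cases ha : a = i
    · by_cases hb : b = j
      · subst ha hb
        exact absurd hs h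
      · simp [hb]
    · simp [ha]

/-- The entries above the diagonal of the matrix of a bilinear form. -/
def upperPart (α : (Fin m → F) →ₗ[F] (Fin m → F) →ₗ[F] F) (s : UpperPairs m) : F :=
  α (Pi.single s.1.1 1) (Pi.single s.1.2 1)

theorem alternating_eq_upperForm_sub (α : (Fin m → F) →ₗ[F] (Fin m → F) →ₗ[F] F)
    (hα : ∀ v, α v v = 0) (v w : Fin m → F) :
    α v w = upperForm (upperPart α) v w - upperForm (upperPart α) w v := by
  have hneg (v w) : α v w = -α w v := by
    have := hα (v + w)
    simp only [map_add, LinearMap.add_apply, hα, zero_add, add_zero] at this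
    exact eq_neg_of_add_eq_zero_right this
  have : α = upperForm (upperPart α) - (upperForm (upperPart α)).flip := by
    refine LinearMap.ext_basis (Pi.basisFun F (Fin m)) (Pi.basisFun F (Fin m)) fun i j => ?_
    simp only [Pi.basisFun_apply, LinearMap.sub_apply, LinearMap.flip_apply, upperForm_single,
      upperPart]
    rcases lt_trichotomy i j with h | rfl | h
    · simp [h, h.not_gt]
    · simp [hα]
    · simp [h, h.not_gt, hneg (Pi.single i 1)]
  exact congrArg (fun β => β v w) this

theorem eq_upperPart_of_upperForm_sub (M : UpperPairs m → F)
    (α : (Fin m → F) →ₗ[F] (Fin m → F) →ₗ[F] F)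
    (h : ∀ v w, upperForm M v w - upperForm M w v = α v w) : M = upperPart α := by
  ext ⟨⟨i, j⟩, hs⟩
  have := h (Pi.single i 1) (Pi.single j 1)
  rw [upperForm_single, upperForm_single, dif_pos hs, dif_neg (lt_asymm hs), sub_zero] at this
  exact this

end UpperForm

namespace HeisenbergCoord

variable {p m : ℕ} [Fact p.Prime] (C : HeisenbergCoord p m G) (ι : ZMod p →+ D)

/-- The cocycle on `G` inflated from a bilinear form with strictly upper triangular matrix. -/
def upperCocycle : (UpperPairs m → ZMod p) →+ cocycles2 G D where
  toFun M := ⟨fun g h => ι (upperForm M (C.π g) (C.π h)), fun g h k => by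
    simp only [C.π_mul, map_add, LinearMap.add_apply]
    abel⟩
  map_zero' := by
    ext g h
    simp [upperForm_apply]
  map_add' M N := by
    ext g h
    simp [upperForm_add]

theorem upperCocycle_apply (M : UpperPairs m → ZMod p) (g h : G) :
    (C.upperCocycle ι M).1 g h = ι (upperForm M (C.π g) (C.π h)) := rfl

/-- The cohomology class on `G` inflated from a bilinear form with strictly upper triangular
matrix. -/
def upperClass : (UpperPairs m → ZMod p) →+ H2 G D :=
  (QuotientAddGroup.mk' _).comp (C.upperCocycle ι)

theorem upperClass_apply (M : UpperPairs m → ZMod p) :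
    C.upperClass ι M = H2mk (C.upperCocycle ι M) := rfl

variable {ι}

theorem upperClass_surjective [DivisibleBy D ℤ] (hm : 2 < m) (hι : Function.Injective ι)
    (hι' : ∀ d, p • d = 0 → ∃ k, ι k = d) : Function.Surjective (C.upperClass ι) := by
  intro x
  obtain ⟨f, rfl⟩ := H2mk_surjective x
  obtain ⟨F, φ, hf⟩ := C.exists_eq_inflated_add_coboundary hm f
  set A : (Fin m → ZMod p) → (Fin m → ZMod p) → D :=
    fun v w => F.1 (.ofAdd v) (.ofAdd w) - F.1 (.ofAdd w) (.ofAdd v)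
  have A_left (u v w) : A (u + v) w = A u w + A v w := antisymm_mul_left F _ _ _
  have A_neg (v w) : A v w = -A w v := (neg_sub _ _).symm
  have A_right (u v w) : A u (v + w) = A u v + A u w := by
    rw [A_neg, A_left, neg_add, ← A_neg, ← A_neg]
  have A_torsion (v w) : p • A v w = 0 := by
    have := map_nsmul (AddMonoidHom.mk' (A · w) (A_left · · w)) p v
    rw [ZModModule.char_nsmul_eq_zero, map_zero] at this
    exact this.symm
  choose a ha using fun v w => hι' _ (A_torsion v w)
  obtain ⟨α, hα⟩ := exists_bilinear_of_biadditive (p := p) a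
    (fun u v w => hι (by rw [map_add, ha, ha, ha, A_left]))
    (fun u v w => hι (by rw [map_add, ha, ha, ha, A_right]))
  have α_self (v) : α v v = 0 := hι (by rw [hα, ha, map_zero]; exact sub_self _)
  set M := upperPart α
  refine ⟨M, ?_⟩
  refine (sub_eq_zero.1 ?_).symm
  change H2mk (f - C.upperCocycle ι M) = 0
  rw [H2mk_eq_zero_iff]
  have key (g h) : (f - C.upperCocycle ι M - coboundary φ).1 g h =
      F.1 (.ofAdd (C.π g)) (.ofAdd (C.π h)) - ι (upperForm M (C.π g) (C.π h)) := by
    change f.1 g h - ι _ - (φ g + φ h - φ (g * h)) = _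
    rw [hf]
    abel
  obtain ⟨ψ, hψ⟩ := C.exists_cobounding_of_symm_of_inflated (f - C.upperCocycle ι M - coboundary φ)
    (fun g g' h h' hg hh => by rw [key, key, hg, hh])
    (fun g h => by
      have := ha (C.π g) (C.π h)
      rw [← hα, alternating_eq_upperForm_sub α α_self, map_sub] at this
      rw [key, key, sub_eq_sub_iff_sub_eq_sub]
      exact this.symm)
  refine ⟨ψ + φ, fun g h => ?_⟩
  have h₁ := hψ g h
  change (f - C.upperCocycle ι M).1 g h - (φ g + φ h - φ (g * h)) = _ at h₁
  rw [sub_eq_iff_eq_add.1 h₁]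
  simp only [Pi.add_apply]
  abel

theorem upperClass_smul_upperPart_ω [DivisibleBy D ℤ] (c : ZMod p) :
    C.upperClass ι (c • upperPart C.ω) = 0 := by
  rw [upperClass_apply, H2mk_eq_zero_iff]
  set φ : G → D := fun g => -ι (c * C.κ g) with hφ
  have key (g h) : (C.upperCocycle ι (c • upperPart C.ω) - coboundary φ).1 g h =
      ι (c * upperForm (upperPart C.ω) (C.π g) (C.π h))
        + ι (c * (C.κ g + C.κ h - C.κ (g * h))) := by
    change ι (upperForm (c • upperPart C.ω) (C.π g) (C.π h)) - (φ g + φ h - φ (g * h)) = _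
    rw [upperForm_smul]
    simp only [hφ, mul_add, mul_sub, map_add, map_sub]
    abel
  obtain ⟨ψ, hψ⟩ := C.exists_cobounding_of_symm_of_inflated _
    (fun g g' h h' hg hh => by
      rw [key, key, hg, hh]
      obtain ⟨k, rfl⟩ := C.exists_eq_mul_ζ hg
      obtain ⟨l, rfl⟩ := C.exists_eq_mul_ζ hh
      have : g' * C.ζ k * (h' * C.ζ l) = g' * h' * C.ζ (k + l) := by
        rw [C.ζ_add, mul_assoc, ← mul_assoc _ h', C.ζ_comm]
        simp only [mul_assoc]
      rw [this, C.κ_mul_ζ, C.κ_mul_ζ, C.κ_mul_ζ]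
      ring_nf)
    (fun g h => by
      rw [key, key, ← map_add, ← map_add, C.mul_eq g h, C.ζ_comm, C.κ_mul_ζ,
        alternating_eq_upperForm_sub C.ω C.ω_self (C.π g)]
      ring_nf)
  refine ⟨ψ + φ, fun g h => ?_⟩
  have h₁ := hψ g h
  change (C.upperCocycle ι (c • upperPart C.ω)).1 g h - (φ g + φ h - φ (g * h)) = _ at h₁
  rw [sub_eq_iff_eq_add.1 h₁]
  simp only [Pi.add_apply]
  abel

theorem upperClass_eq_zero_iff [DivisibleBy D ℤ] (hι : Function.Injective ι)
    (hι' : ∀ d, p • d = 0 → ∃ k, ι k = d) (M : UpperPairs m → ZMod p) :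
    C.upperClass ι M = 0 ↔ ∃ c : ZMod p, c • upperPart C.ω = M := by
  refine ⟨fun h => ?_, fun ⟨c, hc⟩ => hc ▸ C.upperClass_smul_upperPart_ω c⟩
  rw [upperClass_apply, H2mk_eq_zero_iff] at h
  obtain ⟨φ, hφ⟩ := h
  simp only [upperCocycle_apply] at hφ
  have φ_mul (k g) : φ (C.ζ k * g) = φ (C.ζ k) + φ g := by
    have := hφ (C.ζ k) g
    rw [C.π_ζ, map_zero, LinearMap.zero_apply, map_zero] at this
    exact (sub_eq_zero.1 this.symm).symm
  set χ : ZMod p →+ D := AddMonoidHom.mk' (fun k => φ (C.ζ k)) fun k l => by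
    rw [C.ζ_add, φ_mul]
  obtain ⟨c, hc⟩ := hι' (χ 1) (by
    rw [← map_nsmul, ZModModule.char_nsmul_eq_zero, map_zero])
  have χ_apply (k : ZMod p) : χ k = ι (c * k) := by
    obtain ⟨k, rfl⟩ := ZMod.natCast_zmod_surjective k
    rw [mul_comm, ← nsmul_eq_mul, map_nsmul, hc, ← map_nsmul, nsmul_one]
  refine ⟨-c, ?_⟩
  have := eq_upperPart_of_upperForm_sub M (-c • C.ω) fun v w => by
    obtain ⟨g, rfl⟩ := C.π_surjective v
    obtain ⟨h, rfl⟩ := C.π_surjective w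
    apply hι
    have h₁ : φ (g * h) = χ (C.ω (C.π g) (C.π h)) + φ (h * g) := by
      rw [C.mul_eq, φ_mul]
      rfl
    rw [map_sub, hφ, hφ, h₁, χ_apply, LinearMap.smul_apply, LinearMap.smul_apply, smul_eq_mul,
      neg_mul, map_neg]
    abel
  rw [this]
  rfl

theorem card_H2_mul (C : HeisenbergCoord p m G) [DivisibleBy D ℤ] (hm : 2 < m) (hι : Function.Injective ι)
    (hι' : ∀ d, p • d = 0 → ∃ k, ι k = d) :
    Nat.card (H2 G D) * p = p ^ (m * (m - 1) / 2) := by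
  have h₁ := (C.upperClass ι).ker.card_eq_card_quotient_mul_card_addSubgroup
  rw [Nat.card_congr (QuotientAddGroup.quotientKerEquivOfSurjective _
    (C.upperClass_surjective hm hι hι')).toEquiv, Nat.card_fun, card_upperPairs, Nat.card_zmod] at h₁
  have hU : upperPart C.ω ≠ 0 := by
    intro h
    have := C.nondegenerate (fun _ => 1) fun w => by
      rw [alternating_eq_upperForm_sub C.ω C.ω_self, h]
      simp [upperForm_apply]
    exact one_ne_zero (congrFun this ⟨0, by omega⟩)
  have hker : Nat.card (C.upperClass ι).ker = p := by
    refine (Nat.card_congr (Equiv.ofBijective (fun c : ZMod p =>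
      (⟨c • upperPart C.ω, C.upperClass_smul_upperPart_ω c⟩ : (C.upperClass ι).ker))
        ⟨fun c d h => ?_, fun ⟨M, hM⟩ => ?_⟩)).symm.trans (Nat.card_zmod p)
    · exact smul_left_injective _ hU (congrArg Subtype.val h)
    · obtain ⟨c, hc⟩ := (C.upperClass_eq_zero_iff hι hι' M).1 hM
      exact ⟨c, Subtype.ext hc⟩
  rw [h₁, hker]

end HeisenbergCoord

theorem exists_addEquiv_of_card {p m : ℕ} [Fact p.Prime] {V : Type} [AddCommGroup V] [Finite V]
    (hV : ∀ x : V, p • x = 0) (hcard : Nat.card V = p ^ m) :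
    Nonempty (V ≃+ (Fin m → ZMod p)) := by
  have : Module (ZMod p) V := AddCommGroup.zmodModule hV
  have h : Nat.card V = Nat.card (ZMod p) ^ Module.finrank (ZMod p) V :=
    Module.natCard_eq_pow_finrank
  rw [Nat.card_zmod, hcard] at h
  have hrank : Module.finrank (ZMod p) V = Module.finrank (ZMod p) (Fin m → ZMod p) := by
    rw [Module.finrank_fin_fun]
    exact (Nat.pow_right_injective (Fact.out : p.Prime).two_le h).symm
  exact ⟨(LinearEquiv.ofFinrankEq _ _ hrank).toAddEquiv⟩

theorem exists_heisenbergCoord {p m : ℕ} [Fact p.Prime] [Finite G]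
    (hcard : Nat.card G = p ^ (m + 1)) (hcen : Subgroup.center G = commutator G)
    (hcencard : Nat.card (Subgroup.center G) = p) (helem : ∀ x : G ⧸ Subgroup.center G, x ^ p = 1) :
    Nonempty (HeisenbergCoord p m G) := by
  have hp0 : 0 < p := (Fact.out : p.Prime).pos
  have comm_mem (g h : G) : g * h * (h * g)⁻¹ ∈ Subgroup.center G := by
    rw [hcen, mul_inv_rev, ← mul_assoc]
    exact Subgroup.commutator_mem_commutator (Subgroup.mem_top g) (Subgroup.mem_top h)
  let _ : CommGroup (G ⧸ Subgroup.center G) :=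
    { (inferInstance : Group (G ⧸ Subgroup.center G)) with
      mul_comm := fun x y => by
        obtain ⟨g, rfl⟩ := QuotientGroup.mk_surjective x
        obtain ⟨h, rfl⟩ := QuotientGroup.mk_surjective y
        refine (QuotientGroup.eq_iff_div_mem (N := Subgroup.center G)).2 ?_
        rw [div_eq_mul_inv]
        exact comm_mem g h }
  have : Finite (Additive (G ⧸ Subgroup.center G)) :=
    inferInstanceAs (Finite (G ⧸ Subgroup.center G))
  obtain ⟨e⟩ := exists_addEquiv_of_card (p := p) (m := m) (V := Additive (G ⧸ Subgroup.center G))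
    helem (by
      have h := Subgroup.card_eq_card_quotient_mul_card_subgroup (Subgroup.center G)
      rw [hcard, hcencard, pow_succ] at h
      exact (Nat.eq_of_mul_eq_mul_right hp0 h).symm)
  let π : G → Fin m → ZMod p := fun g => e (.ofMul (QuotientGroup.mk g))
  have π_mul (g h) : π (g * h) = π g + π h :=
    map_add e (.ofMul (QuotientGroup.mk g)) (.ofMul (QuotientGroup.mk h))
  have π_surj : Function.Surjective π :=
    e.surjective.comp (Additive.ofMul.surjective.comp QuotientGroup.mk_surjective)
  have π_zero (g) : π g = 0 ↔ g ∈ Subgroup.center G :=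
    e.map_eq_zero_iff.trans (QuotientGroup.eq_one_iff g)
  let z : Multiplicative (ZMod p) ≃* Subgroup.center G :=
    mulEquivOfPrimeCardEq (p := p) (Nat.card_zmod p) hcencard
  let ζ : ZMod p → G := fun k => z (.ofAdd k)
  have ζ_add (k l) : ζ (k + l) = ζ k * ζ l := congrArg Subtype.val (map_mul z _ _)
  have ζ_inj : Function.Injective ζ :=
    Subtype.val_injective.comp (z.injective.comp Multiplicative.ofAdd.injective)
  have ζ_mem (k) : ζ k ∈ Subgroup.center G := (z _).2
  have ζ_comm (k) (g : G) : g * ζ k = ζ k * g := Subgroup.mem_center_iff.1 (ζ_mem k) g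
  have exists_ζ {g : G} (hg : g ∈ Subgroup.center G) : ∃ k, ζ k = g :=
    ⟨(z.symm ⟨g, hg⟩).toAdd, by simp [ζ]⟩
  have ζ_zero : ζ 0 = 1 := by simpa using ζ_add 0 0
  have exists_comm (g h : G) : ∃ k, g * h = ζ k * (h * g) := by
    obtain ⟨k, hk⟩ := exists_ζ (comm_mem g h)
    exact ⟨k, by rw [hk, inv_mul_cancel_right]⟩
  choose c hc using exists_comm
  have c_unique {g h : G} {k : ZMod p} (hk : g * h = ζ k * (h * g)) : c g h = k :=
    ζ_inj (mul_right_cancel ((hc g h).symm.trans hk))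
  have c_mul (g g' h) : c (g * g') h = c g h + c g' h := c_unique <| by
    rw [mul_assoc, hc g' h, ← mul_assoc, ζ_comm, mul_assoc, ← mul_assoc g, hc g h, add_comm, ζ_add]
    simp only [mul_assoc]
  have c_swap (g h) : c g h = -c h g := c_unique <| by
    rw [hc h g, ← mul_assoc, ← ζ_add, neg_add_cancel, ζ_zero, one_mul]
  have c_central (k h) : c (ζ k) h = 0 := c_unique <| by
    rw [ζ_zero, one_mul, ζ_comm]
  have c_congr_left {g g'} (h) (hg : π g = π g') : c g h = c g' h := by
    obtain ⟨k, hk⟩ := exists_ζ <| (π_zero (g * g'⁻¹)).1 <| by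
      have h₁ := π_mul (g * g'⁻¹) g'
      rw [inv_mul_cancel_right, hg] at h₁
      simpa using h₁
    rw [← inv_mul_cancel_right g g', c_mul, ← hk, c_central, zero_add]
  have c_congr {g g' h h'} (hg : π g = π g') (hh : π h = π h') : c g h = c g' h' := by
    rw [c_congr_left h hg, c_swap, c_congr_left g' hh, ← c_swap]
  let s := Function.surjInv π_surj
  have hs (v) : π (s v) = v := Function.surjInv_eq π_surj v
  have c_add (u v w) : c (s (u + v)) w = c (s u) w + c (s v) w := by
    rw [← c_mul]
    exact c_congr (by rw [π_mul, hs, hs, hs]) rfl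
  obtain ⟨ω, hω⟩ := exists_bilinear_of_biadditive (p := p) (fun v w => c (s v) (s w))
    (fun u v w => c_add u v _) (fun u v w => by
      rw [c_swap, c_add, neg_add, ← c_swap, ← c_swap])
  have hω' (g h) : ω (π g) (π h) = c g h := (hω _ _).trans (c_congr (hs _) (hs _))
  exact ⟨{
    π, ζ, ω, π_mul
    π_surjective := π_surj
    ζ_add
    ζ_injective := ζ_inj
    π_eq_zero_iff := fun g =>
      (π_zero g).trans ⟨exists_ζ, fun ⟨k, hk⟩ => hk ▸ ζ_mem k⟩
    mul_eq := fun g h => by rw [hω', hc]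
    nondegenerate := fun v hv => by
      obtain ⟨g, rfl⟩ := π_surj v
      refine (π_zero g).2 (Subgroup.mem_center_iff.2 fun h => ?_)
      rw [hc g h, ← hω', hv, ζ_zero, one_mul] }⟩

/-- The multiplicative group of an algebraically closed field is divisible. -/
noncomputable instance divisibleByUnits {K : Type} [Field K] [IsAlgClosed K] :
    DivisibleBy (Additive Kˣ) ℤ :=
  have : DivisibleBy (Additive Kˣ) ℕ := divisibleByOfSMulRightSurj _ _ fun {n} hn d => by
    obtain ⟨x, hx⟩ := IsAlgClosed.exists_pow_nat_eq (d.toMul : K) (Nat.pos_of_ne_zero hn)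
    have hx0 : x ≠ 0 := by
      rintro rfl
      rw [zero_pow hn] at hx
      exact d.toMul.ne_zero hx.symm
    exact ⟨.ofMul (Units.mk0 x hx0), congrArg Additive.ofMul (Units.ext ((Units.val_pow_eq_pow_val _ _).trans hx))⟩
  AddGroup.divisibleByIntOfDivisibleByNat _

theorem exists_zmod_embedding_units (p : ℕ) (hp : p ≠ 0) :
    ∃ ι : ZMod p →+ Additive ℂˣ, Function.Injective ι ∧ ∀ d, p • d = 0 → ∃ k, ι k = d := by
  have : NeZero p := ⟨hp⟩
  have h := (Complex.isPrimitiveRoot_exp p hp).isUnit_unit hp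
  refine ⟨(MonoidHom.toAdditive (Subgroup.subtype _)).comp h.zmodEquivZPowers.toAddMonoidHom,
    Subtype.val_injective.comp h.zmodEquivZPowers.injective, fun d hd => ?_⟩
  have hmem : d.toMul ∈ Subgroup.zpowers _ := h.zpowers_eq ▸ (mem_rootsOfUnity p d.toMul).2 hd
  exact ⟨h.zmodEquivZPowers.symm (.ofMul ⟨d.toMul, hmem⟩), by simp⟩

/-- The Schur multiplier `M(G) = H²(G, ℂ*)` of an extraspecial `p`-group of order
`p^(2n+1)`, `n ≥ 2`, is elementary abelian of order `p^(2n² - n - 1)`. -/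
theorem schurMultiplier_extraspecial (p n : ℕ) (hp : p.Prime) (hn : 2 ≤ n)
    (G : Type) [Group G] [Finite G]
    (hcard : Nat.card G = p ^ (2 * n + 1))
    (hcen : Subgroup.center G = commutator G)
    (hcencard : Nat.card (Subgroup.center G) = p)
    (helem : ∀ x : G ⧸ Subgroup.center G, x ^ p = 1) :
    (∀ x : H2 G (Additive ℂˣ), p • x = 0) ∧
    Nat.card (H2 G (Additive ℂˣ)) = p ^ (2 * n ^ 2 - n - 1) := by
  have : Fact p.Prime := ⟨hp⟩
  obtain ⟨C⟩ := exists_heisenbergCoord hcard hcen hcencard helem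
  obtain ⟨ι, hι, hι'⟩ := exists_zmod_embedding_units p hp.ne_zero
  have hm : 2 < 2 * n := by omega
  refine ⟨fun x => ?_, ?_⟩
  · obtain ⟨M, rfl⟩ := C.upperClass_surjective hm hι hι' x
    rw [← map_nsmul, ZModModule.char_nsmul_eq_zero, map_zero]
  · have h := C.card_H2_mul hm hι hι'
    obtain ⟨k, rfl⟩ := Nat.exists_eq_add_of_le hn
    have e₁ : 2 * (2 + k) * (2 * (2 + k) - 1) / 2 = 2 * k ^ 2 + 7 * k + 6 := by
      rw [mul_assoc, Nat.mul_div_cancel_left _ two_pos,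
        show 2 * (2 + k) - 1 = 2 * k + 3 by omega]
      ring
    have e₂ : 2 * (2 + k) ^ 2 - (2 + k) - 1 = 2 * k ^ 2 + 7 * k + 5 := by
      rw [show 2 * (2 + k) ^ 2 = 2 * k ^ 2 + 8 * k + 8 by ring]
      omega
    rw [e₁, pow_succ] at h
    rw [e₂]
    exact Nat.eq_of_mul_eq_mul_right hp.pos h

end SchurCP
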